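/- arXiv:math/0304496 — 3 statements merged into one kernel-verified Lean document; each statement's English description precedes it below -/
import Mathlib

section
/- Let h ≥ 2. There exists a constant C > 0 depending only on h such that for all positive integers k ≤ n, one has B_{h-1}(k, n) - B_h(k, n) ≤ C · C(n, k) · k^{2h}/n, where B_h(k,n) denotes the number of B_h-sets of cardinality k contained in {1,2,...,n}. -/
/-- `repFn A h m` is the representation function `r_{A,h}(m)`: the number (as an
extended natural number) of nondecreasing `h`-tuples `(a_1, …, a_h)` of elements of `A`
with `a_1 + ⋯ + a_h = m`. -/
noncomputable def repFn (A : Set ℤ) (h : ℕ) (m : ℤ) : ℕ∞ :=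
  {f : Fin h → ℤ | (∀ i, f i ∈ A) ∧ Monotone f ∧ ∑ i, f i = m}.encard

/-- `A` is a `B_h[g]`-set: every integer has at most `g` representations as a sum of
`h` nondecreasing elements of `A`. -/
def IsBhg (A : Set ℤ) (h g : ℕ) : Prop := ∀ m : ℤ, repFn A h m ≤ (g : ℕ∞)

/-- `countBhg h g k n` is the number of `B_h[g]`-sets of cardinality `k`
contained in `{1, 2, …, n}`. -/
noncomputable def countBhg (h g k n : ℕ) : ℕ :=
  Set.ncard {A : Finset ℤ | ↑A ⊆ Set.Icc (1 : ℤ) (n : ℤ) ∧ A.card = k ∧ IsBhg ↑A h g}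

/-- `countBh h k n` is the number of `B_h`-sets of cardinality `k` contained in
`{1, 2, …, n}`. -/
noncomputable def countBh (h k n : ℕ) : ℕ := countBhg h 1 k n

open Finset in
/-- Two distinct monotone tuples attain some value a different number of times. -/
theorem exists_count_ne_of_monotone {h : ℕ} {f g : Fin h → ℤ} (hf : Monotone f)
    (hg : Monotone g) (hfg : f ≠ g) :
    ∃ x, #{j | f j = x} ≠ #{j | g j = x} := by
  by_contra! H
  apply hfg
  apply List.ofFn_injective
  refine List.Perm.eq_of_sortedLE hf.sortedLE_ofFn hg.sortedLE_ofFn ?_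
  rw [← Multiset.coe_eq_coe]
  have key : ∀ u : Fin h → ℤ, (List.ofFn u : Multiset ℤ) = Multiset.map u univ.val := by
    intro u
    simp [List.ofFn_eq_map, Fin.univ_val_map]
  rw [key, key, Multiset.ext]
  intro x
  rw [Multiset.count_map, Multiset.count_map]
  simpa only [Finset.card_def, Finset.filter_val, eq_comm] using H x

/-- The unknown `x` in the equation `x + ∑ P = ∑ Q`, in which every zero entry of `P` and `Q`
also stands for `x`. -/
def solveUnknown {m l : ℕ} (P : Fin m → ℤ) (Q : Fin l → ℤ) : ℤ :=
  (∑ j, Q j - ∑ j, P j) /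
    (1 + ∑ j, (if P j = 0 then 1 else 0) - ∑ j, (if Q j = 0 then 1 else 0))

/-- The possible values of `solveUnknown` when the entries come from `B` or are zero. -/
def unknowns (m l : ℕ) (B : Finset ℤ) : Finset ℤ :=
  (Fintype.piFinset (fun _ : Fin m => insert 0 B) ×ˢ
    Fintype.piFinset (fun _ : Fin l => insert 0 B)).image fun p => solveUnknown p.1 p.2

theorem card_unknowns_le (m l : ℕ) (B : Finset ℤ) :
    (unknowns m l B).card ≤ (B.card + 1) ^ (m + l) := by
  refine Finset.card_image_le.trans ?_
  rw [Finset.card_product, Fintype.card_piFinset, Fintype.card_piFinset, pow_add]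
  simp only [Finset.prod_const, Finset.card_univ, Fintype.card_fin]
  gcongr <;> exact Finset.card_insert_le _ _

open Finset in
/-- If two tuples in `A` have equal sums but attain the value `f i` differently often, then
`f i` is recovered from the other elements of `A`. -/
theorem mem_unknowns_erase {m : ℕ} {A : Finset ℤ} (hA : 0 ∉ A) {f g : Fin (m + 1) → ℤ}
    (hf : ∀ j, f j ∈ A) (hg : ∀ j, g j ∈ A) (hsum : ∑ j, f j = ∑ j, g j) (i : Fin (m + 1))
    (hc : #{j | f j = f i} ≠ #{j | g j = f i}) :
    f i ∈ unknowns m (m + 1) (A.erase (f i)) := by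
  set x := f i with hx
  have hne : ∀ {y}, y ∈ A → y ≠ 0 := fun hy h => hA (h ▸ hy)
  have hmem : ∀ y ∈ A, (if y = x then 0 else y) ∈ insert 0 (A.erase x) := by
    intro y hy
    split_ifs with h <;> simp [h, hy]
  have hzero : ∀ y ∈ A, ((if y = x then 0 else y) = 0 ↔ y = x) := by
    intro y hy
    have := hne hy
    split_ifs with h <;> simp [h, this]
  have hval : ∀ y, y = (if y = x then 0 else y) + x * (if y = x then 1 else 0) := by
    intro y
    split_ifs with h <;> simp [h]
  refine mem_image.2 ⟨(fun j => if f (i.succAbove j) = x then 0 else f (i.succAbove j),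
    fun j => if g j = x then 0 else g j), ?_, ?_⟩
  · simp only [mem_product, Fintype.mem_piFinset]
    exact ⟨fun j => hmem _ (hf _), fun j => hmem _ (hg _)⟩
  · simp only [solveUnknown, hzero _ (hf _), hzero _ (hg _)]
    have hcf : (#{j | f j = x} : ℤ) = 1 + ∑ j, (if f (i.succAbove j) = x then 1 else 0) := by
      rw [card_filter, Nat.cast_sum, Fin.sum_univ_succAbove _ i]
      simp [hx]
    have hcg : (#{j | g j = x} : ℤ) = ∑ j, (if g j = x then 1 else 0) := by
      rw [card_filter, Nat.cast_sum]
      simp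
    rw [← hcf, ← hcg]
    have hden : (#{j | f j = x} : ℤ) - #{j | g j = x} ≠ 0 := by
      rw [sub_ne_zero]
      exact_mod_cast hc
    refine Int.ediv_eq_of_eq_mul_left hden ?_
    have hsf : ∑ j, f (i.succAbove j) = ∑ j, (if f (i.succAbove j) = x then 0
        else f (i.succAbove j)) + x * ∑ j, (if f (i.succAbove j) = x then 1 else 0) := by
      rw [mul_sum, ← sum_add_distrib]
      exact sum_congr rfl fun j _ => hval _
    have hsg : ∑ j, g j = ∑ j, (if g j = x then 0 else g j)
        + x * ∑ j, (if g j = x then 1 else 0) := by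
      rw [mul_sum, ← sum_add_distrib]
      exact sum_congr rfl fun j _ => hval _
    rw [Fin.sum_univ_succAbove _ i, hsf, hsg, ← hx] at hsum
    rw [hcf, hcg]
    linear_combination -hsum

open Finset in
/-- A set that is not a `B_h`-set has an element recovered from its other elements. -/
theorem exists_mem_unknowns_of_not_isBhg {m : ℕ} {A : Finset ℤ} (hA : 0 ∉ A)
    (h : ¬ IsBhg (A : Set ℤ) (m + 1) 1) :
    ∃ x ∈ A, x ∈ unknowns m (m + 1) (A.erase x) := by
  simp only [IsBhg, repFn, not_forall, not_le, Nat.cast_one, Set.one_lt_encard_iff] at h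
  obtain ⟨s, f, g, ⟨hfA, hf, hfs⟩, ⟨hgA, hg, hgs⟩, hfg⟩ := h
  obtain ⟨x, hx⟩ := exists_count_ne_of_monotone hf hg hfg
  by_cases hfx : ∃ i, f i = x
  · obtain ⟨i, rfl⟩ := hfx
    exact ⟨_, hfA i, mem_unknowns_erase hA hfA hgA (hfs.trans hgs.symm) i hx⟩
  by_cases hgx : ∃ i, g i = x
  · obtain ⟨i, rfl⟩ := hgx
    exact ⟨_, hgA i, mem_unknowns_erase hA hgA hfA (hgs.trans hfs.symm) i hx.symm⟩
  push Not at hfx hgx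
  simp [hfx, hgx] at hx

theorem countBhg_eq_card_filter (h g k n : ℕ)
    [DecidablePred fun A : Finset ℤ => IsBhg (A : Set ℤ) h g] :
    countBhg h g k n = (((Finset.Icc (1 : ℤ) n).powersetCard k).filter
      fun A : Finset ℤ => IsBhg (A : Set ℤ) h g).card := by
  rw [countBhg, ← Set.ncard_coe_finset]
  congr 1
  ext A
  simp [Finset.mem_powersetCard, ← Finset.coe_subset, and_assoc]

open scoped Classical in
theorem countBhg_le_choose (h g k n : ℕ) : countBhg h g k n ≤ n.choose k := by
  rw [countBhg_eq_card_filter]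
  refine (Finset.card_filter_le _ _).trans ?_
  simp

open scoped Classical in
/-- Few `(k + 1)`-subsets of `{1, …, n}` fail to be `B_{m+1}`-sets. -/
theorem choose_le_countBh_add (m k n : ℕ) :
    n.choose (k + 1) ≤ countBh (m + 1) (k + 1) n + n.choose k * (k + 1) ^ (2 * m + 1) := by
  have hsplit := Finset.card_filter_add_card_filter_not (s := (Finset.Icc (1 : ℤ) n).powersetCard
    (k + 1)) (fun A : Finset ℤ => IsBhg (A : Set ℤ) (m + 1) 1)
  rw [Finset.card_powersetCard, Int.card_Icc, add_sub_cancel_right, Int.toNat_natCast] at hsplit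
  rw [countBh, countBhg_eq_card_filter, ← hsplit]
  refine Nat.add_le_add_left ?_ _
  calc _ ≤ (((Finset.Icc (1 : ℤ) n).powersetCard k).biUnion fun B =>
        (unknowns m (m + 1) B).image fun x => insert x B).card := by
        refine Finset.card_le_card fun A hA => ?_
        obtain ⟨hA, hbad⟩ := Finset.mem_filter.1 hA
        obtain ⟨hAn, hAk⟩ := Finset.mem_powersetCard.1 hA
        have h0 : (0 : ℤ) ∉ A := fun h => by simpa using hAn h
        obtain ⟨x, hxA, hx⟩ := exists_mem_unknowns_of_not_isBhg h0 hbad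
        refine Finset.mem_biUnion.2 ⟨A.erase x, ?_, ?_⟩
        · rw [Finset.mem_powersetCard, Finset.card_erase_of_mem hxA, hAk]
          exact ⟨(Finset.erase_subset _ _).trans hAn, rfl⟩
        · exact Finset.mem_image.2 ⟨x, hx, Finset.insert_erase hxA⟩
    _ ≤ ((Finset.Icc (1 : ℤ) n).powersetCard k).card * (k + 1) ^ (2 * m + 1) := by
        refine Finset.card_biUnion_le_card_mul _ _ _ fun B hB => ?_
        refine Finset.card_image_le.trans ((card_unknowns_le _ _ _).trans_eq ?_)
        rw [(Finset.mem_powersetCard.1 hB).2]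
        congr 1
        ring
    _ = n.choose k * (k + 1) ^ (2 * m + 1) := by simp

/-- For `h ≥ 2` there is a constant `C > 0` depending only on `h` such that for all
positive integers `k ≤ n`, `B_{h-1}(k,n) - B_h(k,n) ≤ C · C(n,k) · k^{2h} / n`. -/
theorem countBh_sub_countBh_le (h : ℕ) (hh : 2 ≤ h) :
    ∃ C : ℝ, 0 < C ∧ ∀ k n : ℕ, 1 ≤ k → k ≤ n →
      (countBh (h - 1) k n : ℝ) - (countBh h k n : ℝ) ≤
        C * (n.choose k : ℝ) * (k : ℝ) ^ (2 * h) / (n : ℝ) := by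
  refine ⟨2, two_pos, fun k n hk hkn => ?_⟩
  have hn : (0 : ℝ) < n := by exact_mod_cast (by omega : 0 < n)
  have hle : (countBh (h - 1) k n : ℝ) ≤ n.choose k := by
    exact_mod_cast countBhg_le_choose _ _ _ _
  have hkR : (1 : ℝ) ≤ k := by exact_mod_cast hk
  rw [le_div_iff₀ hn]
  rcases lt_or_ge n (2 * k) with hlarge | hsmall
  · have hpow : (k : ℝ) ≤ (k : ℝ) ^ (2 * h) := le_self_pow₀ hkR (by omega)
    have hnk : (n : ℝ) ≤ 2 * (k : ℝ) ^ (2 * h) := by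
      have : (n : ℝ) ≤ 2 * k := by exact_mod_cast hlarge.le
      linarith
    calc _ ≤ (n.choose k : ℝ) * (2 * (k : ℝ) ^ (2 * h)) := by
          gcongr
          have : (0 : ℝ) ≤ countBh h k n := by positivity
          linarith
      _ = _ := by ring
  · obtain ⟨k, rfl⟩ := Nat.exists_eq_add_of_le' hk
    obtain ⟨m, rfl⟩ := Nat.exists_eq_add_of_le' (by omega : 1 ≤ h)
    have hbad : (n.choose (k + 1) : ℝ) ≤
        countBh (m + 1) (k + 1) n + n.choose k * ((k + 1 : ℕ) : ℝ) ^ (2 * m + 1) := by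
      exact_mod_cast choose_le_countBh_add m k n
    have hchoose : (n.choose k : ℝ) * n ≤ 2 * (n.choose (k + 1) * ((k + 1 : ℕ) : ℝ)) := by
      rw [← Nat.cast_mul (n.choose (k + 1)), Nat.choose_succ_right_eq]
      have : n ≤ 2 * (n - k) := by omega
      have := Nat.mul_le_mul_left (n.choose k) this
      rw [mul_left_comm] at this
      exact_mod_cast this
    calc _ ≤ ((n.choose k : ℝ) * ((k + 1 : ℕ) : ℝ) ^ (2 * m + 1)) * n := by
          gcongr
          linarith
      _ = ((n.choose k : ℝ) * n) * ((k + 1 : ℕ) : ℝ) ^ (2 * m + 1) := by ring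
      _ ≤ (2 * (n.choose (k + 1) * ((k + 1 : ℕ) : ℝ))) * ((k + 1 : ℕ) : ℝ) ^ (2 * m + 1) := by
          gcongr
      _ = _ := by ring
end

section
/- Let h ≥ 2 and let (k_n) be a sequence of positive integers with k_n ≤ n for all n and k_n = o(n^{1/(2h)}), i.e., lim_{n→∞} k_n / n^{1/(2h)} = 0. Then lim_{n→∞} B_h(k_n, n) / C(n, k_n) = 1. -/
section

open Finset

/-- The coefficient of the variable indexed by `j` in the difference of the two sums
indexed by `u` and `v`. -/
def fiberDiff {h : ℕ} {ι : Type*} [DecidableEq ι] (u v : Fin h → ι) (j : ι) : ℤ :=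
  (#{i | u i = j} : ℤ) - #{i | v i = j}

lemma sum_fiberDiff_mul {h : ℕ} {ι : Type*} [Fintype ι] [DecidableEq ι] (u v : Fin h → ι)
    (x : ι → ℤ) : ∑ j, fiberDiff u v j * x j = ∑ i, x (u i) - ∑ i, x (v i) := by
  have key : ∀ w : Fin h → ι, ∑ j, (#{i | w i = j} : ℤ) * x j = ∑ i, x (w i) := by
    intro w
    rw [← Finset.sum_fiberwise (s := univ) (g := w)]
    refine Finset.sum_congr rfl fun j _ => ?_
    rw [Finset.sum_congr rfl (g := fun _ => x j) (by simp +contextual)]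
    simp
  simp only [fiberDiff, sub_mul, Finset.sum_sub_distrib, key]

lemma Monotone.eq_of_card_fiber_eq {h : ℕ} {f g : Fin h → ℤ} (hf : Monotone f)
    (hg : Monotone g) (hfg : ∀ a, #{i | f i = a} = #{i | g i = a}) : f = g := by
  apply List.ofFn_injective
  apply List.Perm.eq_of_pairwise' (r := (· ≤ ·))
  · exact List.pairwise_ofFn.2 fun i j hij => hf hij.le
  · exact List.pairwise_ofFn.2 fun i j hij => hg hij.le
  · rw [List.perm_iff_count]
    intro a
    have key : ∀ w : Fin h → ℤ, (List.ofFn w).count a = #{i | w i = a} := by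
      intro w
      rw [List.ofFn_eq_map, ← Multiset.coe_count, ← Multiset.map_coe, Multiset.count_map]
      simp only [Finset.card, Finset.filter, eq_comm]
      rfl
    rw [key, key, hfg]

lemma card_embedding_linear_le {ι : Type*} [Fintype ι] [DecidableEq ι] (S : Finset ℤ)
    (c : ι → ℤ) {j₀ : ι} (hc : c j₀ ≠ 0) :
    #{f : ι ↪ S | ∑ j, c j * (f j : ℤ) = 0} ≤ S.card.descFactorial (Fintype.card ι - 1) := by
  have h1 : Fintype.card ({j : ι // j ≠ j₀} ↪ S) =
      S.card.descFactorial (Fintype.card ι - 1) := by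
    rw [Fintype.card_embedding_eq, Fintype.card_coe]
    simp
  rw [← h1, ← Finset.card_univ]
  refine Finset.card_le_card_of_injOn (fun f => (Function.Embedding.subtype _).trans f)
    (fun _ _ => Finset.mem_coe.2 (Finset.mem_univ _)) ?_
  intro f hf g hg hfg
  simp only [coe_filter, mem_univ, true_and, Set.mem_ofPred_eq] at hf hg
  have hne : ∀ j, j ≠ j₀ → f j = g j := fun j hj => DFunLike.congr_fun hfg ⟨j, hj⟩
  have h0 : f j₀ = g j₀ := by
    rw [← Finset.add_sum_erase _ _ (mem_univ j₀)] at hf hg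
    have : ∑ j ∈ univ.erase j₀, c j * (f j : ℤ) = ∑ j ∈ univ.erase j₀, c j * (g j : ℤ) :=
      Finset.sum_congr rfl fun j hj => by rw [hne j (Finset.ne_of_mem_erase hj)]
    exact Subtype.ext (mul_left_cancel₀ hc (by linarith))
  ext j
  by_cases hj : j = j₀
  · rw [hj, h0]
  · rw [hne j hj]

lemma exists_fiberDiff_ne_zero_of_not_isBhg {h : ℕ} {ι : Type*} [Fintype ι] [DecidableEq ι]
    {A : Finset ℤ} (hA : ¬ IsBhg (A : Set ℤ) h 1) (e : ι ≃ A) :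
    ∃ u v : Fin h → ι, fiberDiff u v ≠ 0 ∧ ∑ j, fiberDiff u v j * (e j : ℤ) = 0 := by
  simp only [IsBhg, not_forall, not_le, repFn, Nat.cast_one, Set.one_lt_encard_iff] at hA
  obtain ⟨m, f, g, ⟨hfA, hf, hfm⟩, ⟨hgA, hg, hgm⟩, hfg⟩ := hA
  refine ⟨fun i => e.symm ⟨f i, hfA i⟩, fun i => e.symm ⟨g i, hgA i⟩, ?_, ?_⟩
  · intro h0
    refine hfg (hf.eq_of_card_fiber_eq hg fun a => ?_)
    by_cases ha : a ∈ A
    · have := congr_fun h0 (e.symm ⟨a, ha⟩)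
      simpa [fiberDiff, sub_eq_zero] using this
    · rw [Finset.filter_false_of_mem, Finset.filter_false_of_mem]
      · rintro i - rfl
        exact ha (hgA i)
      · rintro i - rfl
        exact ha (hfA i)
  · rw [sum_fiberDiff_mul]
    simp [hfm, hgm]

open scoped Classical in
lemma card_not_isBhg_mul_factorial_le (S : Finset ℤ) (h k : ℕ) :
    #{A ∈ S.powersetCard k | ¬ IsBhg ((A : Finset ℤ) : Set ℤ) h 1} * k.factorial ≤
      k ^ (2 * h) * S.card.descFactorial (k - 1) := by
  set B := {A ∈ S.powersetCard k | ¬ IsBhg ((A : Finset ℤ) : Set ℤ) h 1} with hB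
  have hBS : ∀ A ∈ B, A ⊆ S ∧ #A = k ∧ ¬ IsBhg (A : Set ℤ) h 1 := by
    intro A hA
    simpa [hB, mem_powersetCard, and_assoc] using hA
  let E : Finset (Fin k ↪ S) := (univ : Finset ((Fin h → Fin k) × (Fin h → Fin k))).biUnion
    fun p => {f : Fin k ↪ S | fiberDiff p.1 p.2 ≠ 0 ∧
      ∑ j, fiberDiff p.1 p.2 j * (f j : ℤ) = 0}
  have hE : #E ≤ k ^ (2 * h) * S.card.descFactorial (k - 1) := by
    refine (Finset.card_biUnion_le_card_mul _ _ (S.card.descFactorial (k - 1)) ?_).trans_eq ?_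
    · intro p _
      by_cases hp : fiberDiff p.1 p.2 = 0
      · simp [hp]
      · obtain ⟨j₀, hj₀⟩ := Function.ne_iff.1 hp
        simpa [hp] using card_embedding_linear_le S (fiberDiff p.1 p.2) hj₀
    · simp [two_mul, pow_add]
  refine le_trans ?_ hE
  let φ : (Σ A : B, Fin k ≃ (A : Finset ℤ)) → E := fun q =>
    ⟨⟨fun j => ⟨q.2 j, (hBS _ q.1.2).1 (q.2 j).2⟩, fun i j hij =>
      q.2.injective (Subtype.ext (congrArg (fun x : S => (x : ℤ)) hij))⟩, by
      obtain ⟨u, v, h1, h2⟩ := exists_fiberDiff_ne_zero_of_not_isBhg (hBS _ q.1.2).2.2 q.2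
      simp only [E, mem_biUnion, mem_univ, true_and, mem_filter]
      exact ⟨(u, v), h1, h2⟩⟩
  have hφ : Function.Injective φ := by
    rintro ⟨⟨A, hA⟩, e⟩ ⟨⟨A', hA'⟩, e'⟩ hq
    have hv : ∀ j, (e j : ℤ) = e' j := fun j =>
      congrArg (fun x : S => (x : ℤ)) (DFunLike.congr_fun (congrArg Subtype.val hq) j)
    have hAA : A = A' := by
      ext a
      constructor
      · intro ha
        have := hv (e.symm ⟨a, ha⟩)
        rw [Equiv.apply_symm_apply] at this
        rw [show a = _ from this]
        exact (e' _).2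
      · intro ha
        have := hv (e'.symm ⟨a, ha⟩)
        rw [Equiv.apply_symm_apply] at this
        rw [show a = _ from this.symm]
        exact (e _).2
    subst hAA
    have : e = e' := Equiv.ext fun j => Subtype.ext (hv j)
    rw [this]
  have := Fintype.card_le_of_injective φ hφ
  rw [Fintype.card_sigma, Fintype.card_coe] at this
  refine le_trans (le_of_eq ?_) this
  rw [Finset.sum_congr rfl (g := fun _ => k.factorial)]
  · simp
  · intro A _
    have hc : Fintype.card (Fin k) = Fintype.card (A : Finset ℤ) := by
      rw [Fintype.card_fin, Fintype.card_coe, (hBS _ A.2).2.1]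
    rw [Fintype.card_equiv (Fintype.equivOfCardEq hc), Fintype.card_fin]

lemma choose_mul_le_countBh_mul_add (h : ℕ) {k n : ℕ} (hk : 1 ≤ k) :
    countBh h k n ≤ n.choose k ∧
      n.choose k * (n - (k - 1)) ≤
        countBh h k n * (n - (k - 1)) + k ^ (2 * h) * n.choose k := by
  classical
  set S : Finset ℤ := Finset.Icc 1 (n : ℤ) with hS
  have hSn : #S = n := by simp [hS]
  have hcount : countBh h k n = #{A ∈ S.powersetCard k | IsBhg ((A : Finset ℤ) : Set ℤ) h 1} := by
    rw [countBh, countBhg, ← Set.ncard_coe_finset]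
    congr 1
    ext A
    simp [hS, mem_powersetCard, and_assoc, ← Finset.coe_subset]
  have hsum := Finset.card_filter_add_card_filter_not (s := S.powersetCard k)
    (fun A => IsBhg (A : Set ℤ) h 1)
  rw [card_powersetCard, hSn, ← hcount] at hsum
  have hbad := card_not_isBhg_mul_factorial_le S h k
  rw [hSn] at hbad
  set b := #{A ∈ S.powersetCard k | ¬ IsBhg ((A : Finset ℤ) : Set ℤ) h 1}
  refine ⟨by omega, ?_⟩
  have hdesc : (n - (k - 1)) * n.descFactorial (k - 1) = k.factorial * n.choose k := by
    rw [← Nat.descFactorial_succ, Nat.sub_add_cancel hk, Nat.descFactorial_eq_factorial_mul_choose]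
  have hb : b * (n - (k - 1)) ≤ k ^ (2 * h) * n.choose k := by
    refine Nat.le_of_mul_le_mul_right ?_ k.factorial_pos
    calc b * (n - (k - 1)) * k.factorial = b * k.factorial * (n - (k - 1)) := by ring
      _ ≤ k ^ (2 * h) * n.descFactorial (k - 1) * (n - (k - 1)) := Nat.mul_le_mul_right _ hbad
      _ = k ^ (2 * h) * ((n - (k - 1)) * n.descFactorial (k - 1)) := by ring
      _ = k ^ (2 * h) * n.choose k * k.factorial := by rw [hdesc]; ring
  rw [← hsum, add_mul, hsum]
  exact Nat.add_le_add_left hb _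

end

open Filter Topology in
/-- If `h ≥ 2` and `(k_n)` is a sequence of positive integers with `k_n ≤ n` and
`k_n = o(n^{1/(2h)})`, then `B_h(k_n, n) / C(n, k_n) → 1`. -/
theorem countBh_div_choose_tendsto_one (h : ℕ) (hh : 2 ≤ h) (k : ℕ → ℕ)
    (hk : ∀ n : ℕ, 1 ≤ n → 1 ≤ k n ∧ k n ≤ n)
    (hko : Tendsto (fun n : ℕ => (k n : ℝ) / (n : ℝ) ^ ((1 : ℝ) / (2 * h)))
      atTop (𝓝 0)) :
    Tendsto (fun n : ℕ => (countBh h (k n) n : ℝ) / (n.choose (k n) : ℝ))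
      atTop (𝓝 1) := by
  have hpow : Tendsto (fun n : ℕ => (k n : ℝ) ^ (2 * h) / n) atTop (𝓝 0) := by
    have := hko.pow (2 * h)
    rw [zero_pow (by omega)] at this
    refine this.congr fun n => ?_
    rw [div_pow, ← Real.rpow_natCast ((n : ℝ) ^ _), ← Real.rpow_mul n.cast_nonneg]
    have : (1 : ℝ) / (2 * h) * ((2 * h : ℕ) : ℝ) = 1 := by
      have : (h : ℝ) ≠ 0 := by positivity
      push_cast
      field_simp
    rw [this, Real.rpow_one]
  have hlow : Tendsto (fun n : ℕ => 1 - 2 * ((k n : ℝ) ^ (2 * h) / n)) atTop (𝓝 1) := by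
    simpa using (hpow.const_mul 2).const_sub 1
  refine tendsto_of_tendsto_of_tendsto_of_le_of_le' hlow tendsto_const_nhds ?_ ?_
  · filter_upwards [hpow.eventually_lt_const (show (0 : ℝ) < 1 / 2 by norm_num),
      eventually_ge_atTop 1] with n hn hn1
    obtain ⟨hk1, hkn⟩ := hk n hn1
    obtain ⟨-, hmain⟩ := choose_mul_le_countBh_mul_add h (n := n) hk1
    have hn0 : (0 : ℝ) < n := by exact_mod_cast hn1
    have hC : (0 : ℝ) < n.choose (k n) := by exact_mod_cast Nat.choose_pos hkn
    have hkk : (k n : ℝ) ≤ (k n : ℝ) ^ (2 * h) :=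
      le_self_pow₀ (by exact_mod_cast hk1) (by omega)
    rw [div_lt_iff₀ hn0] at hn
    have hd : (n : ℝ) / 2 ≤ ((n - (k n - 1) : ℕ) : ℝ) := by
      have : n - (k n - 1) + k n = n + 1 := by omega
      have : ((n - (k n - 1) : ℕ) : ℝ) + k n = n + 1 := by exact_mod_cast this
      linarith
    have hmain' : (n.choose (k n) : ℝ) * ((n - (k n - 1) : ℕ) : ℝ) ≤
        countBh h (k n) n * ((n - (k n - 1) : ℕ) : ℝ) + (k n : ℝ) ^ (2 * h) * n.choose (k n) := by
      exact_mod_cast hmain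
    set d : ℝ := ((n - (k n - 1) : ℕ) : ℝ)
    have hd0 : 0 < d := by linarith
    have h1 : 1 - (k n : ℝ) ^ (2 * h) / d ≤ countBh h (k n) n / n.choose (k n) := by
      rw [sub_le_iff_le_add, div_add_div _ _ hC.ne' hd0.ne', le_div_iff₀ (by positivity)]
      linarith
    have h2 : (k n : ℝ) ^ (2 * h) / d ≤ 2 * ((k n : ℝ) ^ (2 * h) / n) := by
      calc (k n : ℝ) ^ (2 * h) / d ≤ (k n : ℝ) ^ (2 * h) / (n / 2) := by gcongr
        _ = 2 * ((k n : ℝ) ^ (2 * h) / n) := by field_simp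
    linarith
  · filter_upwards [eventually_ge_atTop 1] with n hn1
    refine div_le_one_of_le₀ ?_ (Nat.cast_nonneg _)
    exact_mod_cast (choose_mul_le_countBh_mul_add h (hk n hn1).1).1
end

section
/- Let g, k, n, m be positive integers with m ≤ 2n. The number of subsets A ⊆ {1,2,...,n} with |A| = k and r_{A,2}(m) ≥ g+1 is at most C(⌊(m-1)/2⌋, g+1) · C(n - 2g - 2, k - 2g - 2) + C(⌊(m-1)/2⌋, g) · C(n - 2g - 1, k - 2g - 1). -/
/-- The binomial coefficient `C(a, b)` for integer arguments, with the convention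
that `C(a, b) = 0` when `b < 0` or `b > a`. -/
def intChoose (a b : ℤ) : ℕ := if 0 ≤ b ∧ b ≤ a then a.toNat.choose b.toNat else 0

/-- Among the `k`-subsets of `U`, those containing a fixed `c`-set number at most
`C(|U| - c, k - c)`. -/
lemma card_powersetCard_filter_subset_le (U B : Finset ℤ) (k : ℕ) :
    ((U.powersetCard k).filter (fun A => B ⊆ A)).card ≤
      intChoose ((U.card : ℤ) - B.card) ((k : ℤ) - B.card) := by
  rcases ((U.powersetCard k).filter (fun A => B ⊆ A)).eq_empty_or_nonempty with h | ⟨A₀, h₀⟩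
  · simp [h]
  · simp only [Finset.mem_filter, Finset.mem_powersetCard] at h₀
    obtain ⟨⟨hAU, hAk⟩, hBA⟩ := h₀
    have hBk : B.card ≤ k := hAk ▸ Finset.card_le_card hBA
    have hkU : k ≤ U.card := hAk ▸ Finset.card_le_card hAU
    rw [intChoose, if_pos ⟨by omega, by omega⟩,
      show ((U.card : ℤ) - B.card).toNat = U.card - B.card by omega,
      show ((k : ℤ) - B.card).toNat = k - B.card by omega,
      ← Finset.card_sdiff_of_subset (hBA.trans hAU), ← Finset.card_powersetCard]
    refine Finset.card_le_card_of_injOn (fun A => A \ B) ?_ ?_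
    · intro A hA
      simp only [Finset.coe_filter, Finset.mem_powersetCard, Set.mem_ofPred_eq] at hA
      simp only [Finset.mem_coe, Finset.mem_powersetCard]
      refine ⟨Finset.sdiff_subset_sdiff hA.1.1 le_rfl, ?_⟩
      rw [Finset.card_sdiff_of_subset hA.2, hA.1.2]
    · intro A hA A' hA' hAA'
      simp only [Finset.coe_filter, Finset.mem_powersetCard, Set.mem_ofPred_eq] at hA hA'
      rw [← Finset.sdiff_union_of_subset hA.2, ← Finset.sdiff_union_of_subset hA'.2]
      exact congrArg (· ∪ B) hAA'

/-- Union bound: the `k`-subsets of `U` containing some `c`-set of a family indexed by `P`. -/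
lemma card_powersetCard_filter_exists_subset_le {ι : Type*} (U : Finset ℤ) (k c : ℕ)
    (P : Finset ι) (f : ι → Finset ℤ) :
    ((U.powersetCard k).filter (fun A => ∃ T ∈ P, (f T).card = c ∧ f T ⊆ A)).card ≤
      P.card * intChoose ((U.card : ℤ) - c) ((k : ℤ) - c) := by
  classical
  calc _ ≤ ((P.filter (fun T => (f T).card = c)).biUnion
          (fun T => (U.powersetCard k).filter (fun A => f T ⊆ A))).card := by
        refine Finset.card_le_card fun A hA => ?_
        simp only [Finset.mem_filter, Finset.mem_biUnion] at hA ⊢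
        obtain ⟨hA, T, hT, hc, hTA⟩ := hA
        exact ⟨T, ⟨hT, hc⟩, hA, hTA⟩
    _ ≤ (P.filter (fun T => (f T).card = c)).card *
          intChoose ((U.card : ℤ) - c) ((k : ℤ) - c) := by
        refine Finset.card_biUnion_le_card_mul _ _ _ fun T hT => ?_
        rw [← (Finset.mem_filter.1 hT).2]
        exact card_powersetCard_filter_subset_le U (f T) k
    _ ≤ _ := Nat.mul_le_mul_right _ (Finset.card_filter_le _ _)

lemma card_powersetCard_Icc_one (N : ℤ) (hN : 0 ≤ N) (t : ℕ) :
    ((Finset.Icc 1 N).powersetCard t).card = intChoose N t := by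
  rw [Finset.card_powersetCard, Int.card_Icc, intChoose, add_sub_cancel_right]
  split_ifs with h
  · simp
  · exact Nat.choose_eq_zero_of_lt (by omega)

/-- A representation `m = a + b` with `a ≤ b` is determined by `a`. -/
lemma repFn_two_le (A : Finset ℤ) (m : ℤ) :
    repFn ↑A 2 m ≤ (A.filter (fun a => 2 * a ≤ m ∧ m - a ∈ A)).card := by
  rw [repFn, ← Set.encard_coe_eq_coe_finsetCard]
  refine Set.encard_le_encard_of_injOn (f := fun x : Fin 2 → ℤ => x 0) ?_ ?_
  · rintro x ⟨hx, hmono, hsum⟩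
    rw [Fin.sum_univ_two] at hsum
    have h01 : x 0 ≤ x 1 := hmono (by simp)
    simp only [Finset.coe_filter, Set.mem_ofPred_eq]
    refine ⟨hx 0, by omega, ?_⟩
    rw [← hsum, add_sub_cancel_left]
    exact hx 1
  · rintro x ⟨-, -, hx⟩ y ⟨-, -, hy⟩ hxy
    rw [Fin.sum_univ_two] at hx hy
    have hxy : x 0 = y 0 := hxy
    funext i
    fin_cases i
    · exact hxy
    · change x 1 = y 1
      omega

lemma card_union_image_sub {T : Finset ℤ} {m : ℤ} (hT : ∀ a ∈ T, 2 * a < m) :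
    (T ∪ T.image (fun a => m - a)).card = 2 * T.card := by
  rw [Finset.card_union_of_disjoint, Finset.card_image_of_injective _ sub_right_injective,
    two_mul]
  rw [Finset.disjoint_left]
  intro a ha ha'
  obtain ⟨b, hb, rfl⟩ := Finset.mem_image.1 ha'
  have := hT _ ha
  have := hT _ hb
  omega

/-- A set of positive integers with at least `g + 1` representations of `m` contains either
`g + 1` pairs `{a, m - a}` with `a < m - a`, or `g` such pairs together with `m / 2`. -/
lemma exists_pairs_subset_of_le_repFn {A : Finset ℤ} {g : ℕ} {m : ℤ} (hA : ∀ a ∈ A, 1 ≤ a)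
    (h : (g : ℕ∞) + 1 ≤ repFn ↑A 2 m) :
    (∃ T ∈ (Finset.Icc 1 ((m - 1) / 2)).powersetCard (g + 1),
      (T ∪ T.image (fun a => m - a)).card = 2 * g + 2 ∧ T ∪ T.image (fun a => m - a) ⊆ A) ∨
    ∃ T ∈ (Finset.Icc 1 ((m - 1) / 2)).powersetCard g,
      (insert (m / 2) (T ∪ T.image (fun a => m - a))).card = 2 * g + 1 ∧
        insert (m / 2) (T ∪ T.image (fun a => m - a)) ⊆ A := by
  set R := A.filter (fun a => 2 * a ≤ m ∧ m - a ∈ A) with hR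
  set S := A.filter (fun a => 2 * a < m ∧ m - a ∈ A) with hS
  have hRc : g + 1 ≤ R.card := by exact_mod_cast h.trans (repFn_two_le A m)
  have hSI : S ⊆ Finset.Icc 1 ((m - 1) / 2) := by
    intro a ha
    rw [hS, Finset.mem_filter] at ha
    have := hA a ha.1
    rw [Finset.mem_Icc]
    omega
  have hlt : ∀ T ⊆ S, ∀ a ∈ T, 2 * a < m := fun T hT a ha =>
    (Finset.mem_filter.1 (hT ha)).2.1
  have hsub : ∀ T ⊆ S, T ∪ T.image (fun a => m - a) ⊆ A := by
    intro T hT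
    refine Finset.union_subset (hT.trans (Finset.filter_subset _ _)) ?_
    intro b hb
    obtain ⟨a, ha, rfl⟩ := Finset.mem_image.1 hb
    exact (Finset.mem_filter.1 (hT ha)).2.2
  by_cases hSc : g + 1 ≤ S.card
  · obtain ⟨T, hTS, hT⟩ := Finset.exists_subset_card_eq hSc
    refine Or.inl ⟨T, Finset.mem_powersetCard.2 ⟨hTS.trans hSI, hT⟩, ?_, hsub T hTS⟩
    rw [card_union_image_sub (hlt T hTS), hT]
    ring
  · have hRS : R ⊆ insert (m / 2) S := by
      intro a ha
      rw [hR, Finset.mem_filter] at ha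
      rw [Finset.mem_insert, hS, Finset.mem_filter]
      by_cases h2 : 2 * a < m
      · exact Or.inr ⟨ha.1, h2, ha.2.2⟩
      · left
        omega
    have hle := (Finset.card_le_card hRS).trans (Finset.card_insert_le _ _)
    obtain ⟨c, hcR, hcS⟩ := Finset.exists_mem_notMem_of_card_lt_card
      (show S.card < R.card by omega)
    rw [hR, Finset.mem_filter] at hcR
    have hc : 2 * c = m := by
      by_contra hne
      exact hcS (Finset.mem_filter.2 ⟨hcR.1, by omega, hcR.2.2⟩)
    have hcm : m / 2 = c := by omega
    obtain ⟨T, hTS, hT⟩ := Finset.exists_subset_card_eq (show g ≤ S.card by omega)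
    refine Or.inr ⟨T, Finset.mem_powersetCard.2 ⟨hTS.trans hSI, hT⟩, ?_, ?_⟩
    · rw [Finset.card_insert_of_notMem, card_union_image_sub (hlt T hTS), hT]
      intro hmem
      rcases Finset.mem_union.1 hmem with hmem | hmem
      · have := hlt T hTS _ hmem
        omega
      · obtain ⟨a, ha, hac⟩ := Finset.mem_image.1 hmem
        have := hlt T hTS a ha
        omega
    · exact Finset.insert_subset (hcm ▸ hcR.1) (hsub T hTS)

/-- For positive integers `g, k, n, m` with `m ≤ 2n`, the number of subsets
`A ⊆ {1, …, n}` with `|A| = k` and `r_{A,2}(m) ≥ g + 1` is at most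
`C(⌊(m-1)/2⌋, g+1) · C(n-2g-2, k-2g-2) + C(⌊(m-1)/2⌋, g) · C(n-2g-1, k-2g-1)`. -/
theorem count_repFn_ge_le (g k n m : ℕ) (hg : 1 ≤ g) (hk : 1 ≤ k) (hn : 1 ≤ n)
    (hm : 1 ≤ m) (hmn : m ≤ 2 * n) :
    Set.ncard {A : Finset ℤ | ↑A ⊆ Set.Icc (1 : ℤ) (n : ℤ) ∧ A.card = k ∧
        ((g : ℕ∞) + 1) ≤ repFn ↑A 2 (m : ℤ)} ≤
      intChoose (((m : ℤ) - 1) / 2) ((g : ℤ) + 1) *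
          intChoose ((n : ℤ) - 2 * g - 2) ((k : ℤ) - 2 * g - 2) +
        intChoose (((m : ℤ) - 1) / 2) (g : ℤ) *
          intChoose ((n : ℤ) - 2 * g - 1) ((k : ℤ) - 2 * g - 1) := by
  have hI : ((Finset.Icc (1 : ℤ) n).card : ℤ) = n := by simp
  have hN : (0 : ℤ) ≤ ((m : ℤ) - 1) / 2 := by omega
  have h₁ := card_powersetCard_filter_exists_subset_le (Finset.Icc (1 : ℤ) n) k (2 * g + 2)
    ((Finset.Icc 1 (((m : ℤ) - 1) / 2)).powersetCard (g + 1))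
    (fun T => T ∪ T.image (fun a => (m : ℤ) - a))
  have h₂ := card_powersetCard_filter_exists_subset_le (Finset.Icc (1 : ℤ) n) k (2 * g + 1)
    ((Finset.Icc 1 (((m : ℤ) - 1) / 2)).powersetCard g)
    (fun T => insert ((m : ℤ) / 2) (T ∪ T.image (fun a => (m : ℤ) - a)))
  rw [card_powersetCard_Icc_one _ hN, hI] at h₁ h₂
  push_cast at h₁ h₂
  simp only [← sub_sub] at h₁ h₂
  refine le_trans ?_ (add_le_add h₁ h₂)
  refine le_trans ?_ (Finset.card_union_le _ _)
  rw [← Set.ncard_coe_finset]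
  refine Set.ncard_le_ncard ?_ (Finset.finite_toSet _)
  rintro A ⟨hAn, hAk, hA⟩
  have hAI : A ∈ (Finset.Icc (1 : ℤ) n).powersetCard k :=
    Finset.mem_powersetCard.2 ⟨by rwa [← Finset.coe_subset, Finset.coe_Icc], hAk⟩
  rw [Finset.mem_coe, Finset.mem_union, Finset.mem_filter, Finset.mem_filter]
  exact (exists_pairs_subset_of_le_repFn (fun a ha => (hAn ha).1) hA).imp
    (fun h => ⟨hAI, h⟩) (fun h => ⟨hAI, h⟩)
end
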